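/- Let T and T' be two trees whose vertex sets are contained in the vertex set V of a μ-near metric space GD = (V, binom(V,2), d_GD), such that V(T) ⊆ V(T') and d_GD(T) ≤ α · d_GD(MST(GD[V(T)])) for some α ≥ 1. Then d_GD(T') ≥ d_GD(T) / (2αμ). -/

import Mathlib

open SimpleGraph

/-- The total weight of the edges of a subgraph of the complete graph. -/
noncomputable def subWeight {V : Type*} (d : Sym2 V → ℝ)
    (H : (⊤ : SimpleGraph V).Subgraph) : ℝ :=
  ∑ᶠ e ∈ H.edgeSet, d e

/-- The length of the path that starts at `a` and then visits the points of a list in order. -/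
noncomputable def pathLength {V : Type*} [MetricSpace V] : V → List V → ℝ
  | _, [] => 0
  | a, b :: l => dist a b + pathLength b l

theorem pathLength_le_dist_add {V : Type*} [MetricSpace V] (a b : V) (l : List V) :
    pathLength a l ≤ dist a b + pathLength b l := by
  cases l with
  | nil => simp [pathLength]
  | cons c l =>
    have := dist_triangle a b c
    simp only [pathLength]
    linarith

theorem pathLength_le_of_sublist {V : Type*} [MetricSpace V] {l₁ l₂ : List V}
    (h : l₁.Sublist l₂) (a : V) : pathLength a l₁ ≤ pathLength a l₂ := by
  induction h generalizing a with
  | slnil => exact le_rfl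
  | cons b _ ih => exact (pathLength_le_dist_add a b _).trans (add_le_add_right (ih b) _)
  | cons_cons b _ ih => exact add_le_add_right (ih b) _

theorem exists_pathLength_detour {V : Type*} [MetricSpace V] (u w : V) (l : List V) (a : V)
    (hu : u ∈ a :: l) :
    ∃ l', pathLength a l' = pathLength a l + 2 * dist u w ∧
      ∀ x, x ∈ a :: l' ↔ x = w ∨ x ∈ a :: l := by
  have detour_at_start (l : List V) :
      ∃ l', pathLength u l' = pathLength u l + 2 * dist u w ∧
        ∀ x, x ∈ u :: l' ↔ x = w ∨ x ∈ u :: l := by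
    refine ⟨w :: u :: l, ?_, fun x => ?_⟩
    · simp only [pathLength, dist_comm w u]
      ring
    · simp only [List.mem_cons]
      tauto
  induction l generalizing a with
  | nil =>
    obtain rfl : u = a := by simpa using hu
    exact detour_at_start []
  | cons b l ih =>
    obtain rfl | hub := List.mem_cons.1 hu
    · exact detour_at_start (b :: l)
    · obtain ⟨l', hl', hmem⟩ := ih b hub
      refine ⟨b :: l', ?_, fun x => ?_⟩
      · simp only [pathLength, hl']
        ring
      · rw [List.mem_cons, hmem, List.mem_cons (b := a)]
        tauto

theorem subWeight_mono {V : Type*} [Finite V] {d : Sym2 V → ℝ} (hd : ∀ e, 0 ≤ d e)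
    {H K : (⊤ : SimpleGraph V).Subgraph} (h : H ≤ K) : subWeight d H ≤ subWeight d K := by
  classical
  have hs := Subgraph.edgeSet_mono h
  unfold subWeight
  rw [finsum_mem_eq_finite_toFinset_sum _ (Set.toFinite _),
    finsum_mem_eq_finite_toFinset_sum _ (Set.toFinite _)]
  exact Finset.sum_le_sum_of_subset_of_nonneg (by simpa using hs) fun e _ _ => hd e

theorem exists_connected_subWeight_le_pathLength {V : Type*} [Finite V] [MetricSpace V]
    {μ : ℝ} {d : Sym2 V → ℝ} (hd : ∀ e, 0 ≤ d e) (hub : ∀ u v : V, d s(u, v) ≤ μ * dist u v)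
    (l : List V) (a : V) :
    ∃ H : (⊤ : SimpleGraph V).Subgraph, H.Connected ∧ H.verts = {x | x ∈ a :: l} ∧
      subWeight d H ≤ μ * pathLength a l := by
  induction l generalizing a with
  | nil =>
    refine ⟨(⊤ : SimpleGraph V).singletonSubgraph a, Subgraph.singletonSubgraph_connected, ?_, ?_⟩
    · ext; simp
    · simp [subWeight, pathLength]
  | cons b l ih =>
    obtain ⟨H, hH, hv, hw⟩ := ih b
    by_cases hab : a = b
    · subst hab
      exact ⟨H, hH, by rw [hv]; ext; simp, by simpa [pathLength] using hw⟩
    · have hadj : (⊤ : SimpleGraph V).Adj a b := hab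
      refine ⟨H ⊔ subgraphOfAdj _ hadj, ?_, ?_, ?_⟩
      · refine Subgraph.connected_sup hH.preconnected
          (Subgraph.subgraphOfAdj_connected hadj).preconnected ⟨b, ?_⟩
        simp [hv]
      · ext x
        simp only [Subgraph.verts_sup, hv, subgraphOfAdj_verts, Set.mem_union, Set.mem_ofPred_eq,
          Set.mem_insert_iff, Set.mem_singleton_iff, List.mem_cons]
        tauto
      · have hunion := finsum_mem_union_inter (f := d) (Set.toFinite H.edgeSet)
          (Set.toFinite {s(a, b)})
        have hinter : 0 ≤ ∑ᶠ e ∈ H.edgeSet ∩ {s(a, b)}, d e :=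
          finsum_nonneg fun e => finsum_nonneg fun _ => hd e
        rw [finsum_mem_singleton] at hunion
        have := hub a b
        simp only [subWeight, pathLength, Subgraph.edgeSet_sup, edgeSet_subgraphOfAdj, mul_add]
          at hw ⊢
        linarith

theorem SimpleGraph.Subgraph.Connected.exists_isTree_le {V : Type*} [Finite V]
    {G : SimpleGraph V} {H : G.Subgraph} (hH : H.Connected) :
    ∃ K : G.Subgraph, K ≤ H ∧ K.verts = H.verts ∧ K.coe.IsTree := by
  obtain ⟨t, hle, ht⟩ := SimpleGraph.Connected.exists_isTree_le hH.coe
  let K : G.Subgraph :=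
    { verts := H.verts
      Adj u v := ∃ (hu : u ∈ H.verts) (hv : v ∈ H.verts), t.Adj ⟨u, hu⟩ ⟨v, hv⟩
      adj_sub := fun ⟨_, _, h⟩ => H.adj_sub (hle h)
      edge_vert := fun ⟨hu, _, _⟩ => hu
      symm := ⟨fun _ _ ⟨hu, hv, h⟩ => ⟨hv, hu, h.symm⟩⟩ }
  have hK : K.coe = t := by
    ext u v
    exact ⟨fun ⟨_, _, h⟩ => h, fun h => ⟨u.2, v.2, h⟩⟩
  exact ⟨K, ⟨subset_rfl, fun _ _ ⟨_, _, h⟩ => hle h⟩, rfl, by rw [hK]; exact ht⟩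

theorem SimpleGraph.Subgraph.Connected.exists_adj_of_ssubset {V : Type*} {G : SimpleGraph V}
    {H : G.Subgraph} (hH : H.Connected) {A : Set V} (hA : A.Nonempty) (hAH : A ⊂ H.verts) :
    ∃ u ∈ A, ∃ w ∉ A, H.Adj u w := by
  obtain ⟨r, hr⟩ := hA
  obtain ⟨s, hs, hsA⟩ := Set.exists_of_ssubset hAH
  obtain ⟨p⟩ := hH.coe.preconnected ⟨r, hAH.1 hr⟩ ⟨s, hs⟩
  obtain ⟨e, -, h₁, h₂⟩ := p.exists_boundary_dart {x | (x : V) ∈ A} hr hsA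
  exact ⟨_, h₁, _, h₂, e.adj⟩

/-- A connected subgraph can be traversed from any of its vertices by a path which is at most
twice as long as the total weight of its edges. -/
theorem exists_pathLength_le_of_connected {V : Type*} [Finite V] [MetricSpace V]
    {d : Sym2 V → ℝ} (hd : ∀ u v : V, dist u v ≤ d s(u, v))
    {H : (⊤ : SimpleGraph V).Subgraph} (hH : H.Connected) {r : V} (hr : r ∈ H.verts) :
    ∃ l : List V, (∀ x, x ∈ r :: l ↔ x ∈ H.verts) ∧ pathLength r l ≤ 2 * subWeight d H := by
  have hd₀ : ∀ e, 0 ≤ d e := Sym2.ind fun u v => dist_nonneg.trans (hd u v)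
  let P : Set (Set V) := {A | A ⊆ H.verts ∧ ∃ l : List V, (∀ x, x ∈ r :: l ↔ x ∈ A) ∧
    pathLength r l ≤ 2 * subWeight d (H.induce A)}
  have hP : P.Nonempty := by
    refine ⟨{r}, by simpa using hr, [], by simp, ?_⟩
    exact mul_nonneg zero_le_two (finsum_nonneg fun e => finsum_nonneg fun _ => hd₀ e)
  obtain ⟨A, ⟨hAH, l, hl, hlen⟩, hmax⟩ := P.toFinite.exists_maximal hP
  obtain rfl | hss := hAH.eq_or_ssubset
  · exact ⟨l, hl, by simpa using hlen⟩
  obtain ⟨u, hu, w, hw, huw⟩ := hH.exists_adj_of_ssubset ⟨r, (hl r).1 List.mem_cons_self⟩ hss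
  obtain ⟨l', hlen', hl'⟩ := exists_pathLength_detour u w l r ((hl u).2 hu)
  refine absurd (hmax (y := insert w A) ⟨?_, l', fun x => ?_, ?_⟩ (Set.subset_insert w A)
    (Set.mem_insert w A)) hw
  · exact Set.insert_subset huw.snd_mem hAH
  · rw [hl', hl, Set.mem_insert_iff]
  · have hnot : s(u, w) ∉ (H.induce A).edgeSet := by simp [hw]
    have hsub : insert s(u, w) (H.induce A).edgeSet ⊆ (H.induce (insert w A)).edgeSet := by
      refine Set.insert_subset (by simp [hu, huw]) ?_
      exact Subgraph.edgeSet_mono (Subgraph.induce_mono_right (Set.subset_insert w A))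
    have hsum : d s(u, w) + subWeight d (H.induce A) ≤ subWeight d (H.induce (insert w A)) := by
      classical
      unfold subWeight
      rw [← finsum_mem_insert _ hnot (Set.toFinite _),
        finsum_mem_eq_finite_toFinset_sum _ (Set.toFinite _),
        finsum_mem_eq_finite_toFinset_sum _ (Set.toFinite _)]
      exact Finset.sum_le_sum_of_subset_of_nonneg (by simpa using hsub) fun e _ _ => hd₀ e
    have := hd u w
    linarith

/-- Let `T` and `T'` be two trees with vertices in the vertex set `V` of a `μ`-near
metric space `GD = (V, d)` (with underlying metric `dist`), such that
`V(T) ⊆ V(T')` and `d(T) ≤ α · d(MST(GD[V(T)]))` for some `α ≥ 1`, where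
`TM = MST(GD[V(T)])` is a minimum-weight spanning tree of `GD` restricted to
`V(T)`.  Then `d(T') ≥ d(T) / (2αμ)`. -/
theorem stmt12 {V : Type*} [Fintype V] [MetricSpace V]
    (μ α : ℝ) (hμ : 1 ≤ μ) (hα : 1 ≤ α)
    (d : Sym2 V → ℝ)
    (hlb : ∀ u v : V, dist u v ≤ d s(u, v))
    (hub : ∀ u v : V, d s(u, v) ≤ μ * dist u v)
    (T T' : (⊤ : SimpleGraph V).Subgraph)
    (hT : T.coe.IsTree) (hT' : T'.coe.IsTree)
    (hVV : T.verts ⊆ T'.verts)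
    (TM : (⊤ : SimpleGraph V).Subgraph) (hTM : TM.coe.IsTree) (hTMv : TM.verts = T.verts)
    (hTMmin : ∀ T'' : (⊤ : SimpleGraph V).Subgraph, T''.coe.IsTree →
      T''.verts = T.verts → subWeight d TM ≤ subWeight d T'')
    (hTα : subWeight d T ≤ α * subWeight d TM) :
    subWeight d T / (2 * α * μ) ≤ subWeight d T' := by
  classical
  have hd₀ : ∀ e, 0 ≤ d e := Sym2.ind fun u v => dist_nonneg.trans (hlb u v)
  obtain ⟨⟨r, hr⟩⟩ := hT.connected.nonempty
  obtain ⟨l, hl, hlen⟩ := exists_pathLength_le_of_connected hlb ⟨hT'.connected⟩ (hVV hr)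
  obtain ⟨H, hH, hHv, hHw⟩ :=
    exists_connected_subWeight_le_pathLength hd₀ hub (l.filter (· ∈ T.verts)) r
  obtain ⟨K, hKH, hKv, hK⟩ := hH.exists_isTree_le
  have hKT : K.verts = T.verts := by
    ext x
    have := hl x
    have := @hVV x
    simp only [hKv, hHv, List.mem_cons, List.mem_filter, Set.mem_ofPred_eq, decide_eq_true_eq] at *
    grind
  have hμ₀ : 0 < μ := by linarith
  have hα₀ : 0 < α := by linarith
  rw [div_le_iff₀ (by positivity)]
  calc subWeight d T ≤ α * subWeight d TM := hTα
    _ ≤ α * subWeight d K := by gcongr; exact hTMmin K hK hKT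
    _ ≤ α * subWeight d H := by gcongr; exact subWeight_mono hd₀ hKH
    _ ≤ α * (μ * pathLength r (l.filter (· ∈ T.verts))) := by gcongr
    _ ≤ α * (μ * pathLength r l) := by gcongr; exact pathLength_le_of_sublist List.filter_sublist r
    _ ≤ α * (μ * (2 * subWeight d T')) := by gcongr
    _ = subWeight d T' * (2 * α * μ) := by ring
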